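/- Let a and c be positive natural numbers, let N be a finite set with |N| = a + c, and let m : N → ℝ satisfy 0 ≤ m(x) ≤ 1 for every x ∈ N. Then there exists a subset S ⊆ N with |S| = c such that |(∑_{x∈S} m(x))/c − (∑_{x∈N} m(x))/(a + c)| ≤ 1/c. -/

import Mathlib

/-- If real numbers of absolute value at most `1` sum to zero, then for every `k` there are `k` of
them whose sum has absolute value at most `1`. -/
theorem Finset.exists_subset_card_eq_abs_sum_le_one {α : Type*} {N : Finset α} {f : α → ℝ}
    (hf : ∀ x ∈ N, |f x| ≤ 1) (hsum : ∑ x ∈ N, f x = 0) {k : ℕ} (hk : k ≤ N.card) :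
    ∃ S ⊆ N, S.card = k ∧ |∑ x ∈ S, f x| ≤ 1 := by
  classical
  induction k with
  | zero => exact ⟨∅, by simp⟩
  | succ k ih =>
    obtain ⟨S, hSN, hS, hS1⟩ := ih (by lia)
    have hne : (N \ S).Nonempty := by
      rw [← Finset.card_pos, Finset.card_sdiff_of_subset hSN]
      lia
    have hsplit := Finset.sum_sdiff (f := f) hSN
    obtain ⟨x, hx, hx1⟩ : ∃ x ∈ N \ S, |∑ y ∈ S, f y + f x| ≤ 1 := by
      rcases le_total (∑ y ∈ S, f y) 0 with h | h
      · obtain ⟨x, hx, hfx⟩ := Finset.exists_le_of_sum_le (f := fun _ ↦ (0 : ℝ)) (g := f) hne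
          (by rw [Finset.sum_const_zero]; linarith)
        have := hf x (Finset.mem_sdiff.1 hx).1
        rw [abs_le] at this hS1
        exact ⟨x, hx, abs_le.2 ⟨by linarith, by linarith⟩⟩
      · obtain ⟨x, hx, hfx⟩ := Finset.exists_le_of_sum_le (f := f) (g := fun _ ↦ (0 : ℝ)) hne
          (by rw [Finset.sum_const_zero]; linarith)
        have := hf x (Finset.mem_sdiff.1 hx).1
        rw [abs_le] at this hS1
        exact ⟨x, hx, abs_le.2 ⟨by linarith, by linarith⟩⟩
    rw [Finset.mem_sdiff] at hx
    refine ⟨insert x S, Finset.insert_subset hx.1 hSN, ?_, ?_⟩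
    · rw [Finset.card_insert_of_notMem hx.2, hS]
    · rwa [Finset.sum_insert hx.2, add_comm]

/-- Abstract form of Lemma 1: when a set of `a + c` vertices carries fractional
matching values in `[0,1]`, one can choose `c` of them so that their average
matching value differs from the overall average by at most `1/c`. -/
theorem stmt_1 {α : Type*} (a c : ℕ) (ha : 0 < a) (hc : 0 < c)
    (N : Finset α) (hN : N.card = a + c)
    (m : α → ℝ) (hm : ∀ x ∈ N, 0 ≤ m x ∧ m x ≤ 1) :
    ∃ S ⊆ N, S.card = c ∧
      |(∑ x ∈ S, m x) / (c : ℝ) - (∑ x ∈ N, m x) / ((a : ℝ) + (c : ℝ))| ≤ 1 / (c : ℝ) := by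
  have hc' : (0 : ℝ) < c := by exact_mod_cast hc
  have hac : (0 : ℝ) < a + c := by positivity
  have hcard : (N.card : ℝ) = a + c := by exact_mod_cast hN
  set μ : ℝ := (∑ x ∈ N, m x) / ((a : ℝ) + (c : ℝ)) with hμ
  have hμ0 : 0 ≤ μ := div_nonneg (Finset.sum_nonneg fun x hx ↦ (hm x hx).1) hac.le
  have hμ1 : μ ≤ 1 := by
    rw [hμ, div_le_one hac, ← hcard]
    simpa using Finset.sum_le_sum fun x hx ↦ (hm x hx).2
  obtain ⟨S, hSN, hS, hS1⟩ := Finset.exists_subset_card_eq_abs_sum_le_one (N := N)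
    (f := fun x ↦ m x - μ) (k := c)
    (fun x hx ↦ abs_le.2 ⟨by linarith [(hm x hx).1], by linarith [(hm x hx).2]⟩)
    (by
      rw [Finset.sum_sub_distrib, Finset.sum_const, nsmul_eq_mul, hcard, hμ,
        mul_div_cancel₀ _ hac.ne', sub_self])
    (by lia)
  refine ⟨S, hSN, hS, ?_⟩
  rw [Finset.sum_sub_distrib, Finset.sum_const, nsmul_eq_mul, hS] at hS1
  rw [div_sub' hc'.ne', abs_div, abs_of_pos hc']
  gcongr
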